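/- Let f = (x+y)² − (x−y)⁵ and g = xy in ℚ[x,y]. For every b ∈ ℚ[s], b satisfies the Bernstein–Sato functional equation for the pair (f, g) if and only if (s + 1)(s + 11/10)(s + 13/10)(s + 17/10)(s + 19/10) divides b in ℚ[s]; that is, b_{f,xy}(s) = (s + 1)(s + 11/10)(s + 13/10)(s + 17/10)(s + 19/10). -/

import Mathlib

open MvPolynomial Polynomial

/-- The iterated formal partial derivative `∂^α = ∏ᵢ ∂_{xᵢ}^{αᵢ}` applied to a
multivariate polynomial (the partial derivatives pairwise commute, so the order
of the fold is immaterial). -/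
noncomputable def pdIter {σ : Type*} [Fintype σ] (α : σ → ℕ)
    (p : MvPolynomial σ ℚ) : MvPolynomial σ ℚ :=
  Finset.univ.toList.foldl (fun q i => (⇑(MvPolynomial.pderiv i))^[α i] q) p

/-- `b ∈ ℚ[s]` satisfies the Bernstein–Sato functional equation for the pair
`(f, g)`: there are finitely many multi-indices `α` and polynomials
`p_α ∈ (ℚ[x])[s]` with `b(m)·g·f^m = Σ_α p_α(m)·∂^α(g·f^(m+1))` for all `m ∈ ℕ`. -/
def SatisfiesBS {σ : Type*} [Fintype σ] (f g : MvPolynomial σ ℚ)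
    (b : Polynomial ℚ) : Prop :=
  ∃ (A : Finset (σ → ℕ)) (p : (σ → ℕ) → Polynomial (MvPolynomial σ ℚ)),
    ∀ m : ℕ,
      MvPolynomial.C (Polynomial.eval (m : ℚ) b) * g * f ^ m =
        ∑ α ∈ A, Polynomial.eval ((m : ℕ) : MvPolynomial σ ℚ) (p α) *
          pdIter α (g * f ^ (m + 1))

section Operators

/-- Applying a derivation to the coefficients of `p ∈ R[s]` commutes with evaluation at rational
numbers. -/
lemma exists_eval_eq_derivation_eval {R : Type*} [CommRing R] [Algebra ℚ R]
    (D : Derivation ℚ R R) (p : Polynomial R) :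
    ∃ p' : Polynomial R, ∀ q : ℚ,
      p'.eval (algebraMap ℚ R q) = D (p.eval (algebraMap ℚ R q)) := by
  induction p using Polynomial.induction_on' with
  | add p q hp hq =>
    obtain ⟨p', hp⟩ := hp
    obtain ⟨q', hq⟩ := hq
    exact ⟨p' + q', fun r => by simp [hp, hq]⟩
  | monomial n a =>
    refine ⟨Polynomial.monomial n (D a), fun q => ?_⟩
    simp only [Polynomial.eval_monomial, ← map_pow, Derivation.leibniz, Derivation.map_algebraMap,
      smul_eq_mul, mul_zero, zero_add]
    ring

variable {σ : Type*}

lemma pderiv_comm (i j : σ) (p : MvPolynomial σ ℚ) :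
    MvPolynomial.pderiv i (MvPolynomial.pderiv j p) =
      MvPolynomial.pderiv j (MvPolynomial.pderiv i p) := by
  classical
  have h : ⁅(MvPolynomial.pderiv i : Derivation ℚ (MvPolynomial σ ℚ) (MvPolynomial σ ℚ)),
      (MvPolynomial.pderiv j : Derivation ℚ (MvPolynomial σ ℚ) (MvPolynomial σ ℚ))⁆ = 0 := by
    refine MvPolynomial.derivation_ext fun k => ?_
    simp only [Derivation.commutator_apply, MvPolynomial.pderiv_X, Pi.single_apply]
    split_ifs <;> simp
  have := congrArg (fun D => D p) h
  simpa [Derivation.commutator_apply, sub_eq_zero] using this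

lemma pderiv_iterate_comm (i j : σ) (n : ℕ) (p : MvPolynomial σ ℚ) :
    MvPolynomial.pderiv i ((⇑(MvPolynomial.pderiv j))^[n] p) =
      (⇑(MvPolynomial.pderiv j))^[n] (MvPolynomial.pderiv i p) :=
  (Function.Commute.iterate_right (f := ⇑(MvPolynomial.pderiv i))
    (fun q => pderiv_comm i j q) n) p

lemma pderiv_foldl_comm (i : σ) (α : σ → ℕ) (l : List σ) (p : MvPolynomial σ ℚ) :
    MvPolynomial.pderiv i (l.foldl (fun q j => (⇑(MvPolynomial.pderiv j))^[α j] q) p) =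
      l.foldl (fun q j => (⇑(MvPolynomial.pderiv j))^[α j] q) (MvPolynomial.pderiv i p) := by
  induction l generalizing p with
  | nil => rfl
  | cons j l ih => rw [List.foldl_cons, ih, pderiv_iterate_comm, List.foldl_cons]

lemma foldl_update_of_notMem [DecidableEq σ] (i : σ) (n : ℕ) (α : σ → ℕ) (l : List σ)
    (hi : i ∉ l) (p : MvPolynomial σ ℚ) :
    l.foldl (fun q j => (⇑(MvPolynomial.pderiv j))^[Function.update α i n j] q) p =
      l.foldl (fun q j => (⇑(MvPolynomial.pderiv j))^[α j] q) p := by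
  induction l generalizing p with
  | nil => rfl
  | cons j l ih =>
    rw [List.mem_cons, not_or] at hi
    rw [List.foldl_cons, List.foldl_cons, ih hi.2, Function.update_of_ne (Ne.symm hi.1)]

lemma pderiv_foldl [DecidableEq σ] (i : σ) (α : σ → ℕ) (l : List σ) (hl : l.Nodup)
    (hi : i ∈ l) (p : MvPolynomial σ ℚ) :
    MvPolynomial.pderiv i (l.foldl (fun q j => (⇑(MvPolynomial.pderiv j))^[α j] q) p) =
      l.foldl (fun q j =>
        (⇑(MvPolynomial.pderiv j))^[Function.update α i (α i + 1) j] q) p := by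
  induction l generalizing p with
  | nil => simp at hi
  | cons j l ih =>
    rw [List.nodup_cons] at hl
    rw [List.foldl_cons, List.foldl_cons]
    by_cases hij : i = j
    · subst hij
      rw [foldl_update_of_notMem i _ α l hl.1, pderiv_foldl_comm, Function.update_self,
        Function.iterate_succ_apply']
    · rw [ih hl.2 ((List.mem_cons.1 hi).resolve_left hij),
        Function.update_of_ne (Ne.symm hij)]

variable [Fintype σ]

lemma pderiv_pdIter [DecidableEq σ] (i : σ) (α : σ → ℕ) (p : MvPolynomial σ ℚ) :
    MvPolynomial.pderiv i (pdIter α p) = pdIter (Function.update α i (α i + 1)) p :=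
  pderiv_foldl i α _ (Finset.nodup_toList _) (by simp) p

lemma pdIter_zero (p : MvPolynomial σ ℚ) : pdIter 0 p = p := by
  simp only [pdIter, Pi.zero_apply, Function.iterate_zero, id]
  induction (Finset.univ : Finset σ).toList with
  | nil => rfl
  | cons i l ih => exact ih

/-- The family `D_X[s] · g f^(s+1)`, where a family `F(s)` is recorded through its values at the
natural numbers. -/
noncomputable def bsModule (f g : MvPolynomial σ ℚ) :
    Submodule (MvPolynomial σ ℚ) (ℕ → MvPolynomial σ ℚ) where
  carrier := {F | ∃ (A : Finset (σ → ℕ)) (p : (σ → ℕ) → Polynomial (MvPolynomial σ ℚ)),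
    ∀ m : ℕ, F m = ∑ α ∈ A, Polynomial.eval ((m : ℕ) : MvPolynomial σ ℚ) (p α) *
      pdIter α (g * f ^ (m + 1))}
  zero_mem' := ⟨∅, 0, fun m => by simp⟩
  add_mem' := by
    classical
    rintro F G ⟨A, p, hF⟩ ⟨B, q, hG⟩
    refine ⟨A ∪ B, fun α => (if α ∈ A then p α else 0) + (if α ∈ B then q α else 0),
      fun m => ?_⟩
    have key : ∀ (T U : Finset (σ → ℕ)) (r : (σ → ℕ) → Polynomial (MvPolynomial σ ℚ)), T ⊆ U →
        ∑ α ∈ T, Polynomial.eval (m : MvPolynomial σ ℚ) (r α) * pdIter α (g * f ^ (m + 1)) =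
        ∑ α ∈ U, Polynomial.eval (m : MvPolynomial σ ℚ) (if α ∈ T then r α else 0) *
          pdIter α (g * f ^ (m + 1)) := by
      intro T U r hTU
      rw [← Finset.sum_subset hTU]
      · exact Finset.sum_congr rfl fun α hα => by rw [if_pos hα]
      · intro α _ hα
        simp [hα]
    rw [Pi.add_apply, hF, hG, key A _ p Finset.subset_union_left,
      key B _ q Finset.subset_union_right, ← Finset.sum_add_distrib]
    exact Finset.sum_congr rfl fun α _ => by rw [Polynomial.eval_add, add_mul]
  smul_mem' := by
    rintro r F ⟨A, p, hF⟩
    refine ⟨A, fun α => Polynomial.C r * p α, fun m => ?_⟩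
    simp only [Pi.smul_apply, hF, smul_eq_mul, Finset.mul_sum, Polynomial.eval_mul,
      Polynomial.eval_C, mul_assoc]

variable {f g : MvPolynomial σ ℚ}

lemma satisfiesBS_iff_mem {b : Polynomial ℚ} :
    SatisfiesBS f g b ↔
      (fun m : ℕ => MvPolynomial.C (Polynomial.eval (m : ℚ) b) * g * f ^ m) ∈ bsModule f g :=
  Iff.rfl

lemma eval_mul_mem_bsModule (p : Polynomial (MvPolynomial σ ℚ)) {F : ℕ → MvPolynomial σ ℚ}
    (hF : F ∈ bsModule f g) :
    (fun m : ℕ => Polynomial.eval (m : MvPolynomial σ ℚ) p * F m) ∈ bsModule f g := by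
  obtain ⟨A, q, hF⟩ := hF
  refine ⟨A, fun α => p * q α, fun m => ?_⟩
  simp only [hF, Finset.mul_sum, Polynomial.eval_mul, mul_assoc]

lemma pdIter_mem_bsModule (α : σ → ℕ) :
    (fun m => pdIter α (g * f ^ (m + 1))) ∈ bsModule f g :=
  ⟨{α}, fun _ => 1, fun m => by simp⟩

lemma pderiv_mem_bsModule (i : σ) {F : ℕ → MvPolynomial σ ℚ} (hF : F ∈ bsModule f g) :
    (fun m => MvPolynomial.pderiv i (F m)) ∈ bsModule f g := by
  classical
  obtain ⟨A, p, hF⟩ := hF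
  have h : (fun m => MvPolynomial.pderiv i (F m)) =
      ∑ α ∈ A, fun m : ℕ => MvPolynomial.pderiv i
        (Polynomial.eval (m : MvPolynomial σ ℚ) (p α) * pdIter α (g * f ^ (m + 1))) := by
    funext m
    rw [hF, map_sum, Finset.sum_apply]
  rw [h]
  refine Submodule.sum_mem _ fun α _ => ?_
  obtain ⟨p', hp'⟩ := exists_eval_eq_derivation_eval (MvPolynomial.pderiv i) (p α)
  convert (bsModule f g).add_mem (eval_mul_mem_bsModule p' (pdIter_mem_bsModule α))
    (eval_mul_mem_bsModule (p α) (pdIter_mem_bsModule (Function.update α i (α i + 1)))) using 1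
  funext m
  have := hp' m
  rw [map_natCast] at this
  rw [MvPolynomial.pderiv_mul, pderiv_pdIter, ← this, Pi.add_apply]

end Operators

section UpperBound

variable {R : Type*} [CommRing R] [Algebra ℚ R]

/-- For `f = u² - v⁵` the family `(v² - u²) f^s` is mapped into `D[s] (v² - u²) f^(s+1)` by
`(s + 1)(10 s + 11)(10 s + 13)(10 s + 17)(10 s + 19)`. -/
lemma mul_mem_of_derivation_stable (D₁ D₂ : Derivation ℚ R R) {u v f : R}
    (h₁u : D₁ u = 1) (h₁v : D₁ v = 0) (h₂u : D₂ u = 0) (h₂v : D₂ v = 1) (hf : f = u ^ 2 - v ^ 5)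
    (S : Submodule R (ℕ → R)) (hS : ∀ F ∈ S, (fun m : ℕ => (m : R) * F m) ∈ S)
    (hS₁ : ∀ F ∈ S, (fun m => D₁ (F m)) ∈ S) (hS₂ : ∀ F ∈ S, (fun m => D₂ (F m)) ∈ S)
    (hG : (fun m => (v ^ 2 - u ^ 2) * f ^ (m + 1)) ∈ S) :
    (fun m : ℕ => ((m : R) + 1) * (10 * m + 11) * (10 * m + 13) * (10 * m + 17) * (10 * m + 19) *
      ((v ^ 2 - u ^ 2) * f ^ m)) ∈ S := by
  have h₁f : D₁ f = 2 * u := by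
    rw [hf]; simp [h₁u, h₁v]
  have h₂f : D₂ f = -5 * v ^ 4 := by
    rw [hf]; simp [h₂u, h₂v]
  have map_lit (D : Derivation ℚ R R) (n : ℕ) [n.AtLeastTwo] : D (OfNat.ofNat n : R) = 0 :=
    D.map_natCast n
  have leibniz_pow_base (w : R) (D : Derivation ℚ R R) (n : ℕ) :
      D (w ^ n) = n * w ^ (n - 1) * D w := by simp [mul_assoc]
  have euler (m : ℕ) : 5 * u * D₁ (f ^ m) + 2 * v * D₂ (f ^ m) = 10 * m * f ^ m := by
    cases m with
    | zero => simp
    | succ n =>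
      simp only [Derivation.leibniz_pow, h₁f, h₂f, smul_eq_mul, nsmul_eq_mul, add_tsub_cancel_right]
      rw [pow_succ, hf]
      push_cast
      ring
  have of_eq {F G : ℕ → R} (hF : F ∈ S) (h : ∀ m, F m = G m) : G ∈ S := funext h ▸ hF
  have lin (a c : R) {F : ℕ → R} (hF : F ∈ S) : (fun m : ℕ => (a * m + c) * F m) ∈ S :=
    of_eq (S.add_mem (S.smul_mem a (hS F hF)) (S.smul_mem c hF)) fun m => by
      simp only [Pi.add_apply, Pi.smul_apply, smul_eq_mul]; ring
  have cancel (n : ℕ) (hn : n ≠ 0) {F : ℕ → R} (hF : (fun m => (n : R) * F m) ∈ S) : F ∈ S :=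
    of_eq (S.smul_mem (algebraMap ℚ R (n : ℚ)⁻¹) hF) fun m => by
      have : algebraMap ℚ R (n : ℚ)⁻¹ * (n : R) = 1 := by
        rw [← map_natCast (algebraMap ℚ R) n, ← map_mul, inv_mul_cancel₀ (by exact_mod_cast hn),
          map_one]
      simp only [Pi.smul_apply, smul_eq_mul, ← mul_assoc, this, one_mul]
  have vv : (fun m => v ^ 2 * f ^ (m + 1)) ∈ S := by
    refine cancel 6 (by norm_num) (of_eq (S.sub_mem (lin 10 20 hG) (S.add_mem
      (S.smul_mem (5 * u) (hS₁ _ hG)) (S.smul_mem (2 * v) (hS₂ _ hG)))) fun m => ?_)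
    simp [h₁u, h₂u, h₁v, h₂v, h₁f, h₂f]
    rw [hf]
    ring
  have uu : (fun m => u ^ 2 * f ^ (m + 1)) ∈ S :=
    of_eq (S.sub_mem vv hG) fun m => by simp only [Pi.sub_apply]; ring
  have uv : (fun m => u * v * f ^ (m + 1)) ∈ S := by
    refine cancel 4 (by norm_num) (of_eq (S.add_mem
      (S.smul_mem (5 * v ^ 4) (hS₁ _ vv)) (S.smul_mem (2 * u) (hS₂ _ vv))) fun m => ?_)
    simp [h₁v, h₂v, h₁f, h₂f]
    ring
  have uvv : (fun m : ℕ => ((m : R) + 1) * (u * v ^ 2 * f ^ m)) ∈ S := by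
    refine cancel 2 (by norm_num) (of_eq (hS₁ _ vv) fun m => ?_)
    simp [h₁v, h₁f]
    ring
  have vf : (fun m : ℕ => (10 * (m : R) + 19) * (v * f * f ^ m)) ∈ S := by
    refine of_eq (S.add_mem (S.smul_mem 5 (hS₁ _ uv)) (S.smul_mem 2 (hS₂ _ vv))) fun m => ?_
    simp [h₁u, h₁v, h₁f, h₂v, h₂f]
    rw [hf]
    ring
  have uuv : (fun m : ℕ => ((m : R) + 1) * (10 * m + 19) * (u ^ 2 * v * f ^ m)) ∈ S := by
    refine of_eq (S.sub_mem (lin 5 7 (hS₁ _ uv)) (hS₂ _ vv)) fun m => ?_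
    simp [h₁u, h₁v, h₁f, h₂v, h₂f]
    rw [pow_succ, show f ^ m * f = f ^ m * (u ^ 2 - v ^ 5) by rw [← hf]]
    ring
  have uf : (fun m : ℕ => u * f * f ^ m) ∈ S := by
    refine of_eq (S.add_mem (hS₂ _ uv) (S.smul_mem (5 * v ^ 3) uvv)) fun m => ?_
    simp [h₂u, h₂v, h₂f]
    ring
  have uuu : (fun m : ℕ => ((m : R) + 1) * (u ^ 3 * f ^ m)) ∈ S := by
    refine cancel 2 (by norm_num) (of_eq (S.sub_mem (hS₁ _ uu) (S.smul_mem 2 uf)) fun m => ?_)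
    simp [h₁u, h₁f]
    ring
  have uu₀ : (fun m : ℕ => ((m : R) + 1) * (10 * m + 19) * (10 * m + 17) *
      (u ^ 2 * f ^ m)) ∈ S := by
    refine of_eq (S.add_mem (S.smul_mem 5 (hS₁ _ (lin 10 19 uuu)))
      (S.smul_mem 2 (hS₂ _ uuv))) fun m => ?_
    simp [-Derivation.leibniz_pow, leibniz_pow_base u, map_lit, h₁u, h₂u, h₂v]
    linear_combination ((m : R) + 1) * (10 * m + 19) * u ^ 2 * euler m
  have ff : (fun m : ℕ => (10 * (m : R) + 19) * (10 * m + 17) * (f * f ^ m)) ∈ S := by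
    refine of_eq (S.add_mem (S.smul_mem 5 (hS₁ _ (lin 10 19 uf)))
      (S.smul_mem 2 (hS₂ _ vf))) fun m => ?_
    simp [-Derivation.leibniz_pow, map_lit, h₁u, h₂v, h₁f, h₂f]
    rw [hf] at euler ⊢
    linear_combination (10 * (m : R) + 19) * (u ^ 2 - v ^ 5) * euler m
  have v₄ : (fun m : ℕ => ((m : R) + 1) * (10 * m + 19) * (10 * m + 17) * (v ^ 4 * f ^ m)) ∈ S := by
    refine cancel 5 (by norm_num) (of_eq (S.neg_mem (hS₂ _ ff)) fun m => ?_)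
    simp only [← pow_succ']
    simp [map_lit, h₂f]
    ring
  have v₃ : (fun m : ℕ => ((m : R) + 1) * (10 * m + 19) * (10 * m + 17) * (10 * m + 13) *
      (v ^ 3 * f ^ m)) ∈ S := by
    refine of_eq (S.add_mem (S.smul_mem (5 * v) (hS₁ _ (lin 10 17 (lin 10 19 uvv))))
      (S.smul_mem 2 (hS₂ _ v₄))) fun m => ?_
    simp [-Derivation.leibniz_pow, leibniz_pow_base v, map_lit, h₁u, h₁v, h₂v]
    linear_combination ((m : R) + 1) * (10 * m + 19) * (10 * m + 17) * v ^ 3 * euler m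
  have v₂ : (fun m : ℕ => ((m : R) + 1) * (10 * m + 19) * (10 * m + 17) * (10 * m + 13) *
      (10 * m + 11) * (v ^ 2 * f ^ m)) ∈ S := by
    refine of_eq (S.add_mem (S.smul_mem 5 (hS₁ _ (lin 10 13 (lin 10 17 (lin 10 19 uvv)))))
      (S.smul_mem 2 (hS₂ _ v₃))) fun m => ?_
    simp [-Derivation.leibniz_pow, leibniz_pow_base v, map_lit, h₁u, h₁v, h₂v]
    linear_combination ((m : R) + 1) * (10 * m + 19) * (10 * m + 17) * (10 * m + 13) * v ^ 2 *
      euler m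
  exact of_eq (S.sub_mem v₂ (lin 10 13 (lin 10 11 uu₀))) fun m => by
    simp only [Pi.sub_apply]; ring

end UpperBound

section LowerBound

variable {σ : Type*} [Fintype σ]

/-- A criterion for roots: `I k` collects the `h` such that `h f^(α - k)` is negligible, for a
notion of negligible elements which is stable under differential operators and contains
`g f^(α + 1)`. Then `b(α) g f^α` is negligible. -/
lemma exists_pow_mul_mem_of_satisfiesBS {f g : MvPolynomial σ ℚ} (hf : f ≠ 0) (α : ℚ)
    (I : ℕ → Ideal (MvPolynomial σ ℚ))
    (hI : ∀ k, ∀ h ∈ I k, f * h ∈ I (k + 1))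
    (hD : ∀ k i, ∀ h ∈ I k, f * MvPolynomial.pderiv i h +
      MvPolynomial.C (α - k) * (MvPolynomial.pderiv i f * h) ∈ I (k + 1))
    (h₀ : g * f ∈ I 0) {b : Polynomial ℚ} (hb : SatisfiesBS f g b) :
    ∃ k, f ^ k * (MvPolynomial.C (b.eval α) * g) ∈ I k := by
  have hI' (j k : ℕ) {h} (hh : h ∈ I k) : f ^ j * h ∈ I (k + j) := by
    induction j with
    | zero => simpa using hh
    | succ j ih => rw [pow_succ', mul_assoc]; exact hI _ _ ih
  let N : Submodule (MvPolynomial σ ℚ) (ℕ → MvPolynomial σ ℚ) :=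
    { carrier := {F | ∃ (k : ℕ) (h : Polynomial (MvPolynomial σ ℚ)),
        (∀ m : ℕ, f ^ k * F m = h.eval (m : MvPolynomial σ ℚ) * f ^ m) ∧
          h.eval (MvPolynomial.C α) ∈ I k}
      zero_mem' := ⟨0, 0, fun m => by simp, by simp⟩
      add_mem' := by
        rintro F G ⟨k, p, hF, hp⟩ ⟨l, q, hG, hq⟩
        refine ⟨k + l, Polynomial.C (f ^ l) * p + Polynomial.C (f ^ k) * q, fun m => ?_, ?_⟩
        · simp only [Pi.add_apply, Polynomial.eval_add, Polynomial.eval_mul, Polynomial.eval_C]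
          linear_combination f ^ l * hF m + f ^ k * hG m
        · simp only [Polynomial.eval_add, Polynomial.eval_mul, Polynomial.eval_C]
          exact (I _).add_mem (hI' l k hp) (add_comm l k ▸ hI' k l hq)
      smul_mem' := by
        rintro r F ⟨k, p, hF, hp⟩
        refine ⟨k, Polynomial.C r * p, fun m => ?_, ?_⟩
        · simp only [Pi.smul_apply, smul_eq_mul, Polynomial.eval_mul, Polynomial.eval_C]
          linear_combination r * hF m
        · rw [Polynomial.eval_mul, Polynomial.eval_C]
          exact (I k).mul_mem_left _ hp }
  have hpoly (q : Polynomial (MvPolynomial σ ℚ)) {F} (hF : F ∈ N) :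
      (fun m : ℕ => q.eval (m : MvPolynomial σ ℚ) * F m) ∈ N := by
    obtain ⟨k, p, hF, hp⟩ := hF
    refine ⟨k, q * p, fun m => ?_, ?_⟩
    · rw [Polynomial.eval_mul]
      linear_combination q.eval (m : MvPolynomial σ ℚ) * hF m
    · rw [Polynomial.eval_mul]
      exact (I k).mul_mem_left _ hp
  have hpow (i : σ) (n : ℕ) : f * MvPolynomial.pderiv i (f ^ n) =
      n * MvPolynomial.pderiv i f * f ^ n := by
    cases n with
    | zero => simp
    | succ n => rw [MvPolynomial.pderiv_pow, add_tsub_cancel_right]; push_cast; ring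
  have hderiv (i : σ) {F} (hF : F ∈ N) : (fun m => MvPolynomial.pderiv i (F m)) ∈ N := by
    obtain ⟨k, p, hF, hp⟩ := hF
    obtain ⟨p', hp'⟩ := exists_eval_eq_derivation_eval (MvPolynomial.pderiv i) p
    refine ⟨k + 1, Polynomial.C f * p' + (Polynomial.X - Polynomial.C (k : MvPolynomial σ ℚ)) *
      (Polynomial.C (MvPolynomial.pderiv i f) * p), fun m => ?_, ?_⟩
    · have h₁ := congrArg (MvPolynomial.pderiv i) (hF m)
      have h₂ := hp' m
      rw [map_natCast] at h₂
      rw [MvPolynomial.pderiv_mul, MvPolynomial.pderiv_mul] at h₁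
      simp only [Polynomial.eval_add, Polynomial.eval_sub, Polynomial.eval_mul, Polynomial.eval_X,
        Polynomial.eval_C, h₂]
      linear_combination f * h₁ - F m * hpow i k + Polynomial.eval (m : MvPolynomial σ ℚ) p *
        hpow i m - k * MvPolynomial.pderiv i f * hF m
    · have h₂ := hp' α
      rw [MvPolynomial.algebraMap_eq] at h₂
      have := hD k i _ hp
      simpa only [Polynomial.eval_add, Polynomial.eval_sub, Polynomial.eval_mul,
        Polynomial.eval_X, Polynomial.eval_C, Polynomial.eval_natCast, h₂, map_sub,
        map_natCast] using this
  have hiter (i : σ) (n : ℕ) {F} (hF : F ∈ N) :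
      (fun m => (⇑(MvPolynomial.pderiv i))^[n] (F m)) ∈ N := by
    induction n with
    | zero => exact hF
    | succ n ih => simpa only [Function.iterate_succ_apply'] using hderiv i ih
  have hfold (β : σ → ℕ) (l : List σ) {F} (hF : F ∈ N) :
      (fun m => l.foldl (fun q i => (⇑(MvPolynomial.pderiv i))^[β i] q) (F m)) ∈ N := by
    induction l generalizing F with
    | nil => exact hF
    | cons i l ih => exact ih (hiter i (β i) hF)
  have hG : (fun m => g * f ^ (m + 1)) ∈ N :=
    ⟨0, Polynomial.C (g * f), fun m => by rw [Polynomial.eval_C]; ring, by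
      rwa [Polynomial.eval_C]⟩
  obtain ⟨A, p, hA⟩ := hb
  have hmem : (fun m : ℕ => MvPolynomial.C (b.eval (m : ℚ)) * g * f ^ m) ∈ N := by
    have : (fun m : ℕ => MvPolynomial.C (b.eval (m : ℚ)) * g * f ^ m) =
        ∑ β ∈ A, fun m : ℕ => (p β).eval (m : MvPolynomial σ ℚ) *
          pdIter β (g * f ^ (m + 1)) := by
      funext m
      rw [hA, Finset.sum_apply]
    rw [this]
    exact N.sum_mem fun β _ => hpoly (p β) (hfold β _ hG)
  obtain ⟨k, h, hh, hα⟩ := hmem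
  refine ⟨k, ?_⟩
  have key : Polynomial.C (f ^ k) * (b.map MvPolynomial.C * Polynomial.C g) = h := by
    refine Polynomial.eq_of_infinite_eval_eq _ _ (Set.infinite_of_injective_forall_mem
      (f := fun m : ℕ => (m : MvPolynomial σ ℚ)) Nat.cast_injective fun m => ?_)
    refine mul_right_cancel₀ (pow_ne_zero m hf) ?_
    rw [← hh m]
    have : Polynomial.eval (m : MvPolynomial σ ℚ) (b.map MvPolynomial.C) =
        MvPolynomial.C (b.eval (m : ℚ)) := by
      rw [← map_natCast (MvPolynomial.C : ℚ →+* MvPolynomial σ ℚ), Polynomial.eval_map_apply]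
    simp only [Polynomial.eval_mul, Polynomial.eval_C, this]
    ring
  rw [← key] at hα
  simpa only [Polynomial.eval_mul, Polynomial.eval_C, Polynomial.eval_map_apply] using hα

/-- The Dirichlet moments attached to `u^a v^b` for the residue class `r` of `b` modulo `5`. -/
noncomputable def momentCoeff (r n a b : ℕ) : ℚ :=
  if a % 2 = 0 ∧ b % 5 = r ∧ a / 2 + b / 5 = n then
    (-1) ^ (b / 5) * (∏ i ∈ Finset.range (a / 2), (1 / 2 + (i : ℚ))) *
      (∏ i ∈ Finset.range (b / 5), (((r : ℚ) + 1) / 5 + i)) /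
      ∏ i ∈ Finset.range n, (((r : ℚ) + 1) / 5 + 1 / 2 + i)
  else 0

lemma prod_moment_ne_zero (r n : ℕ) :
    ∏ i ∈ Finset.range n, (((r : ℚ) + 1) / 5 + 1 / 2 + i) ≠ 0 :=
  Finset.prod_ne_zero_iff.2 fun i _ => by positivity

lemma momentCoeff_sub (r n a b : ℕ) :
    momentCoeff r (n + 1) (a + 2) b - momentCoeff r (n + 1) a (b + 5) = momentCoeff r n a b := by
  have h₁ : (a + 2) / 2 = a / 2 + 1 := by omega
  have h₂ : (b + 5) / 5 = b / 5 + 1 := by omega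
  unfold momentCoeff
  rw [h₁, h₂, Nat.add_mod_right, Nat.add_mod_right]
  by_cases h : a % 2 = 0 ∧ b % 5 = r ∧ a / 2 + b / 5 = n
  · rw [if_pos h, if_pos (by omega), if_pos (by omega)]
    have hn : (n : ℚ) = ((a / 2 : ℕ) : ℚ) + ((b / 5 : ℕ) : ℚ) := by exact_mod_cast h.2.2.symm
    have h0 := prod_moment_ne_zero r n
    have h1 : ((r : ℚ) + 1) / 5 + 1 / 2 + n ≠ 0 := by positivity
    rw [Finset.prod_range_succ, Finset.prod_range_succ, Finset.prod_range_succ, ← sub_div,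
      div_eq_div_iff (mul_ne_zero h0 h1) h0, hn]
    ring
  · rw [if_neg h, if_neg (by omega), if_neg (by omega), sub_zero]

lemma momentCoeff_left (r n a b : ℕ) :
    (a : ℚ) * momentCoeff r n (a - 1) b =
      2 * (((r : ℚ) + 1) / 5 + 1 / 2 + n) * momentCoeff r (n + 1) (a + 1) b := by
  cases a with
  | zero => simp [momentCoeff]
  | succ a =>
    have h₁ : (a + 1 + 1) / 2 = a / 2 + 1 := by omega
    unfold momentCoeff
    rw [h₁, add_tsub_cancel_right]
    by_cases h : a % 2 = 0 ∧ b % 5 = r ∧ a / 2 + b / 5 = n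
    · rw [if_pos h, if_pos (by omega)]
      have ha : (a : ℚ) = 2 * ((a / 2 : ℕ) : ℚ) := by
        exact_mod_cast (by omega : a = 2 * (a / 2))
      have h0 := prod_moment_ne_zero r n
      have h1 : ((r : ℚ) + 1) / 5 + 1 / 2 + n ≠ 0 := by positivity
      rw [Finset.prod_range_succ, Finset.prod_range_succ, mul_div_assoc', mul_div_assoc',
        div_eq_div_iff h0 (mul_ne_zero h0 h1)]
      push_cast
      generalize ((a / 2 : ℕ) : ℚ) = c at *
      rw [ha]
      ring
    · rw [if_neg h, if_neg (by omega), mul_zero, mul_zero]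

lemma momentCoeff_right {r : ℕ} (hr : r ≠ 4) (n a b : ℕ) :
    (b : ℚ) * momentCoeff r n a (b - 1) =
      -5 * (((r : ℚ) + 1) / 5 + 1 / 2 + n) * momentCoeff r (n + 1) a (b + 4) := by
  cases b with
  | zero => simp [momentCoeff, hr.symm]
  | succ b =>
    have h₁ : (b + 1 + 4) / 5 = b / 5 + 1 := by omega
    unfold momentCoeff
    rw [h₁, add_tsub_cancel_right]
    by_cases h : a % 2 = 0 ∧ b % 5 = r ∧ a / 2 + b / 5 = n
    · rw [if_pos h, if_pos (by omega)]
      have hb : (b : ℚ) = 5 * ((b / 5 : ℕ) : ℚ) + r := by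
        exact_mod_cast (by omega : b = 5 * (b / 5) + r)
      have h0 := prod_moment_ne_zero r n
      have h1 : ((r : ℚ) + 1) / 5 + 1 / 2 + n ≠ 0 := by positivity
      rw [Finset.prod_range_succ, Finset.prod_range_succ, mul_div_assoc', mul_div_assoc',
        div_eq_div_iff h0 (mul_ne_zero h0 h1)]
      push_cast
      generalize ((b / 5 : ℕ) : ℚ) = c at *
      rw [hb]
      ring
    · rw [if_neg h, if_neg (by omega), mul_zero, mul_zero]

/-- The residue functional for `f = u² - v⁵` on forms `p f^s du dv`, restricted to the part of `p`
whose weight is determined by `r` and `n`. -/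
noncomputable def residue (r n : ℕ) : MvPolynomial (Fin 2) ℚ →ₗ[ℚ] ℚ :=
  (MvPolynomial.basisMonomials (Fin 2) ℚ).constr ℚ fun d => momentCoeff r n (d 0) (d 1)

lemma monomial_fin_two (d : Fin 2 →₀ ℕ) :
    (MvPolynomial.monomial d 1 : MvPolynomial (Fin 2) ℚ) =
      MvPolynomial.X 0 ^ d 0 * MvPolynomial.X 1 ^ d 1 := by
  rw [MvPolynomial.monomial_eq, Finsupp.prod_fintype _ _ (by simp)]
  simp

lemma linearMap_ext_fin_two {M : Type*} [AddCommGroup M] [Module ℚ M]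
    {L L' : MvPolynomial (Fin 2) ℚ →ₗ[ℚ] M}
    (h : ∀ a b : ℕ, L (MvPolynomial.X 0 ^ a * MvPolynomial.X 1 ^ b) =
      L' (MvPolynomial.X 0 ^ a * MvPolynomial.X 1 ^ b)) : L = L' :=
  (MvPolynomial.basisMonomials (Fin 2) ℚ).ext fun d => by
    simp only [MvPolynomial.coe_basisMonomials, monomial_fin_two, h]

lemma residue_monomial (r n a b : ℕ) :
    residue r n (MvPolynomial.X 0 ^ a * MvPolynomial.X 1 ^ b) = momentCoeff r n a b := by
  have h := monomial_fin_two (Finsupp.single 0 a + Finsupp.single 1 b)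
  have h₀ : (Finsupp.single (0 : Fin 2) a + Finsupp.single 1 b : Fin 2 →₀ ℕ) 0 = a := by simp
  have h₁ : (Finsupp.single (0 : Fin 2) a + Finsupp.single 1 b : Fin 2 →₀ ℕ) 1 = b := by simp
  rw [h₀, h₁] at h
  rw [← h, residue]
  have := (MvPolynomial.basisMonomials (Fin 2) ℚ).constr_basis ℚ
    (fun d => momentCoeff r n (d 0) (d 1)) (Finsupp.single (0 : Fin 2) a + Finsupp.single 1 b)
  simpa only [MvPolynomial.coe_basisMonomials, h₀, h₁] using this

lemma residue_mul_succ (r n : ℕ) (p : MvPolynomial (Fin 2) ℚ) :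
    residue r (n + 1) ((X 0 ^ 2 - X 1 ^ 5) * p) = residue r n p := by
  have : residue r (n + 1) ∘ₗ LinearMap.mulLeft ℚ (X 0 ^ 2 - X 1 ^ 5) = residue r n := by
    refine linearMap_ext_fin_two fun a b => ?_
    rw [LinearMap.comp_apply, LinearMap.mulLeft_apply, residue_monomial, ← momentCoeff_sub,
      ← residue_monomial, ← residue_monomial, ← map_sub]
    congr 1
    ring
  exact congrArg (fun L => L p) this

lemma residue_mul_zero (r : ℕ) (p : MvPolynomial (Fin 2) ℚ) :
    residue r 0 ((X 0 ^ 2 - X 1 ^ 5) * p) = 0 := by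
  have : residue r 0 ∘ₗ LinearMap.mulLeft ℚ (X 0 ^ 2 - X 1 ^ 5) = 0 := by
    refine linearMap_ext_fin_two fun a b => ?_
    have h : (X 0 ^ 2 - X 1 ^ 5 : MvPolynomial (Fin 2) ℚ) * (X 0 ^ a * X 1 ^ b) =
        X 0 ^ (a + 2) * X 1 ^ b - X 0 ^ a * X 1 ^ (b + 5) := by ring
    rw [LinearMap.comp_apply, LinearMap.mulLeft_apply, h, map_sub, residue_monomial,
      residue_monomial]
    simp [momentCoeff]
  exact congrArg (fun L => L p) this

lemma residue_mul_pow (r n k : ℕ) (p : MvPolynomial (Fin 2) ℚ) :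
    residue r (n + k) ((X 0 ^ 2 - X 1 ^ 5) ^ k * p) = residue r n p := by
  induction k with
  | zero => simp
  | succ k ih => rw [pow_succ', mul_assoc, ← add_assoc, residue_mul_succ, ih]

lemma residue_pderiv_zero (r n : ℕ) (p : MvPolynomial (Fin 2) ℚ) :
    residue r n (MvPolynomial.pderiv 0 p) =
      2 * (((r : ℚ) + 1) / 5 + 1 / 2 + n) * residue r (n + 1) (X 0 * p) := by
  have : residue r n ∘ₗ (MvPolynomial.pderiv 0).toLinearMap =
      (2 * (((r : ℚ) + 1) / 5 + 1 / 2 + n)) •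
        residue r (n + 1) ∘ₗ LinearMap.mulLeft ℚ (X 0) := by
    refine linearMap_ext_fin_two fun a b => ?_
    have h : MvPolynomial.pderiv 0 (X 0 ^ a * X 1 ^ b : MvPolynomial (Fin 2) ℚ) =
        (a : ℚ) • (X 0 ^ (a - 1) * X 1 ^ b) := by
      simp [MvPolynomial.smul_eq_C_mul]
      ring
    rw [LinearMap.smul_apply, LinearMap.comp_apply, LinearMap.comp_apply,
      LinearMap.mulLeft_apply, ← mul_assoc, ← pow_succ', residue_monomial, smul_eq_mul,
      ← momentCoeff_left, ← residue_monomial]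
    exact (congrArg (residue r n) h).trans (map_smul _ _ _)
  exact congrArg (fun L => L p) this

lemma residue_pderiv_one {r : ℕ} (hr : r ≠ 4) (n : ℕ) (p : MvPolynomial (Fin 2) ℚ) :
    residue r n (MvPolynomial.pderiv 1 p) =
      -5 * (((r : ℚ) + 1) / 5 + 1 / 2 + n) * residue r (n + 1) (X 1 ^ 4 * p) := by
  have : residue r n ∘ₗ (MvPolynomial.pderiv 1).toLinearMap =
      (-5 * (((r : ℚ) + 1) / 5 + 1 / 2 + n)) •
        residue r (n + 1) ∘ₗ LinearMap.mulLeft ℚ (X 1 ^ 4) := by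
    refine linearMap_ext_fin_two fun a b => ?_
    have h : MvPolynomial.pderiv 1 (X 0 ^ a * X 1 ^ b : MvPolynomial (Fin 2) ℚ) =
        (b : ℚ) • (X 0 ^ a * X 1 ^ (b - 1)) := by
      simp [MvPolynomial.smul_eq_C_mul]
      ring
    have h' : (X 1 ^ 4 * (X 0 ^ a * X 1 ^ b) : MvPolynomial (Fin 2) ℚ) =
        X 0 ^ a * X 1 ^ (b + 4) := by ring
    rw [LinearMap.smul_apply, LinearMap.comp_apply, LinearMap.comp_apply,
      LinearMap.mulLeft_apply, h', residue_monomial, smul_eq_mul,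
      ← momentCoeff_right hr, ← residue_monomial]
    exact (congrArg (residue r n) h).trans (map_smul _ _ _)
  exact congrArg (fun L => L p) this

lemma residue_C_mul (r n : ℕ) (c : ℚ) (p : MvPolynomial (Fin 2) ℚ) :
    residue r n (MvPolynomial.C c * p) = c * residue r n p := by
  rw [← MvPolynomial.smul_eq_C_mul, map_smul, smul_eq_mul]

/-- The residue pairing is compatible with the vector field `∂ᵤ + ε ∂ᵥ`. -/
lemma residue_mul_twisted_derivative {r n : ℕ} (hr : r ≠ 4) (ε : ℚ)
    {h : MvPolynomial (Fin 2) ℚ} (hh : ∀ q, residue r n (q * h) = 0)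
    (q : MvPolynomial (Fin 2) ℚ) :
    residue r (n + 1) (q * ((X 0 ^ 2 - X 1 ^ 5) *
      (MvPolynomial.pderiv 0 h + MvPolynomial.C ε * MvPolynomial.pderiv 1 h) +
      MvPolynomial.C (-(((r : ℚ) + 1) / 5 + 1 / 2 + n)) *
        ((2 * X 0 - 5 * MvPolynomial.C ε * X 1 ^ 4) * h))) = 0 := by
  set c : ℚ := ((r : ℚ) + 1) / 5 + 1 / 2 + n with hc
  have e : q * ((X 0 ^ 2 - X 1 ^ 5) *
      (MvPolynomial.pderiv 0 h + MvPolynomial.C ε * MvPolynomial.pderiv 1 h) +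
      MvPolynomial.C (-c) * ((2 * X 0 - 5 * MvPolynomial.C ε * X 1 ^ 4) * h)) =
      (X 0 ^ 2 - X 1 ^ 5) * (q * MvPolynomial.pderiv 0 h) +
      MvPolynomial.C ε * ((X 0 ^ 2 - X 1 ^ 5) * (q * MvPolynomial.pderiv 1 h)) -
      MvPolynomial.C (2 * c) * (X 0 * (q * h)) -
      MvPolynomial.C ε * (MvPolynomial.C (-5 * c) * (X 1 ^ 4 * (q * h))) := by
    simp only [map_neg, map_mul, map_ofNat]
    ring
  have h₀ := residue_pderiv_zero r n (q * h)
  have h₁ := residue_pderiv_one hr n (q * h)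
  rw [MvPolynomial.pderiv_mul, map_add, hh, zero_add, ← hc] at h₀ h₁
  rw [e]
  simp only [map_add, map_sub, residue_C_mul, residue_mul_succ, h₀, h₁]
  ring

/-- The change of coordinates sending `x + y` to `u` and `x - y` to `v`. -/
noncomputable def coordChange : MvPolynomial (Fin 2) ℚ →ₐ[ℚ] MvPolynomial (Fin 2) ℚ :=
  MvPolynomial.aeval ![MvPolynomial.C 2⁻¹ * (X 0 + X 1), MvPolynomial.C 2⁻¹ * (X 0 - X 1)]

lemma C_half_mul_two : (MvPolynomial.C 2⁻¹ * 2 : MvPolynomial (Fin 2) ℚ) = 1 := by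
  rw [← map_ofNat (MvPolynomial.C : ℚ →+* MvPolynomial (Fin 2) ℚ) 2, ← map_mul]
  norm_num

lemma coordChange_X_zero : coordChange (X 0) = MvPolynomial.C 2⁻¹ * (X 0 + X 1) :=
  MvPolynomial.aeval_X _ _

lemma coordChange_X_one : coordChange (X 1) = MvPolynomial.C 2⁻¹ * (X 0 - X 1) :=
  MvPolynomial.aeval_X _ _

lemma coordChange_C (c : ℚ) : coordChange (MvPolynomial.C c) = MvPolynomial.C c :=
  coordChange.commutes c

lemma coordChange_pderiv_zero (p : MvPolynomial (Fin 2) ℚ) :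
    coordChange (MvPolynomial.pderiv 0 p) =
      MvPolynomial.pderiv 0 (coordChange p) + MvPolynomial.pderiv 1 (coordChange p) := by
  induction p using MvPolynomial.induction_on with
  | C a => simp
  | add p q hp hq => simp only [map_add, hp, hq]; ring
  | mul_X p i hp =>
    simp only [MvPolynomial.pderiv_mul, map_mul, map_add, hp]
    fin_cases i
    · simp [coordChange_X_zero]
      linear_combination (-coordChange p) * C_half_mul_two
    · simp [coordChange_X_one]
      ring

lemma coordChange_pderiv_one (p : MvPolynomial (Fin 2) ℚ) :
    coordChange (MvPolynomial.pderiv 1 p) =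
      MvPolynomial.pderiv 0 (coordChange p) - MvPolynomial.pderiv 1 (coordChange p) := by
  induction p using MvPolynomial.induction_on with
  | C a => simp
  | add p q hp hq => simp only [map_add, hp, hq]; ring
  | mul_X p i hp =>
    simp only [MvPolynomial.pderiv_mul, map_mul, map_add, hp]
    fin_cases i
    · simp [coordChange_X_zero]
      ring
    · simp [coordChange_X_one]
      linear_combination (-coordChange p) * C_half_mul_two

lemma coordChange_add : coordChange (X 0 + X 1) = X 0 := by
  rw [map_add, coordChange_X_zero, coordChange_X_one]
  linear_combination X 0 * C_half_mul_two

lemma coordChange_sub : coordChange (X 0 - X 1) = X 1 := by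
  rw [map_sub, coordChange_X_zero, coordChange_X_one]
  linear_combination X 1 * C_half_mul_two

lemma coordChange_cusp :
    coordChange ((X 0 + X 1) ^ 2 - (X 0 - X 1) ^ 5) = X 0 ^ 2 - X 1 ^ 5 := by
  rw [map_sub, map_pow, map_pow, coordChange_add, coordChange_sub]

lemma coordChange_X_mul_X :
    coordChange (X 0 * X 1) = MvPolynomial.C 4⁻¹ * (X 0 ^ 2 - X 1 ^ 2) := by
  have : (MvPolynomial.C 4⁻¹ : MvPolynomial (Fin 2) ℚ) =
      MvPolynomial.C 2⁻¹ * MvPolynomial.C 2⁻¹ := by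
    rw [← map_mul]; norm_num
  rw [map_mul, coordChange_X_zero, coordChange_X_one, this]
  ring

lemma cusp_ne_zero : ((X 0 + X 1) ^ 2 - (X 0 - X 1) ^ 5 : MvPolynomial (Fin 2) ℚ) ≠ 0 := by
  intro h
  have := congrArg (MvPolynomial.eval ![1, 1]) h
  norm_num at this

lemma eval_eq_zero_of_residue {r κ : ℕ} (hr : r ≠ 4)
    (h₀ : ∀ q, residue r κ ((X 0 ^ 2 - X 1 ^ 5) * ((X 0 ^ 2 - X 1 ^ 2) * q)) = 0)
    {q : MvPolynomial (Fin 2) ℚ} (hq : residue r κ ((X 0 ^ 2 - X 1 ^ 2) * q) ≠ 0)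
    {b : Polynomial ℚ}
    (hb : SatisfiesBS ((X 0 + X 1) ^ 2 - (X 0 - X 1) ^ 5 : MvPolynomial (Fin 2) ℚ) (X 0 * X 1) b) :
    b.eval (-(((r : ℚ) + 1) / 5 + 1 / 2 + κ)) = 0 := by
  let I (k : ℕ) : Ideal (MvPolynomial (Fin 2) ℚ) :=
    { carrier := {h | ∀ q, residue r (κ + k) (q * coordChange h) = 0}
      zero_mem' := fun q => by simp
      add_mem' := fun {h h'} hh hh' q => by
        rw [map_add coordChange, mul_add, map_add, hh, hh', add_zero]
      smul_mem' := fun c h hh q => by rw [smul_eq_mul, map_mul coordChange, ← mul_assoc, hh] }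
  have key := exists_pow_mul_mem_of_satisfiesBS cusp_ne_zero
    (-(((r : ℚ) + 1) / 5 + 1 / 2 + κ)) I ?_ ?_ ?_ hb
  · obtain ⟨k, hk⟩ := key
    have := hk q
    rw [map_mul coordChange, map_pow coordChange, coordChange_cusp, map_mul coordChange,
      coordChange_C, coordChange_X_mul_X, mul_left_comm,
      residue_mul_pow] at this
    have e (c : ℚ) : q * (MvPolynomial.C c *
        (MvPolynomial.C 4⁻¹ * (X 0 ^ 2 - X 1 ^ 2))) =
        MvPolynomial.C c * (MvPolynomial.C 4⁻¹ * ((X 0 ^ 2 - X 1 ^ 2) * q)) := by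
      ring
    rw [e, residue_C_mul, residue_C_mul] at this
    exact (mul_eq_zero.1 this).resolve_right (mul_ne_zero (by norm_num) hq)
  · intro k h hh q
    rw [map_mul coordChange, coordChange_cusp, mul_left_comm, ← add_assoc, residue_mul_succ]
    exact hh q
  · intro k i h hh q
    have hc : -(((r : ℚ) + 1) / 5 + 1 / 2 + κ) - k =
        -(((r : ℚ) + 1) / 5 + 1 / 2 + (κ + k : ℕ)) := by push_cast; ring
    rw [hc, map_add coordChange, map_mul coordChange, map_mul coordChange, map_mul coordChange,
      coordChange_cusp, coordChange_C]
    fin_cases i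
    · refine (congrArg (residue r (κ + k + 1)) ?_).trans (residue_mul_twisted_derivative hr 1 hh q)
      simp only [Fin.zero_eta, coordChange_pderiv_zero, coordChange_cusp, map_one, one_mul]
      congr 4
      simp
      ring
    · refine (congrArg (residue r (κ + k + 1)) ?_).trans
        (residue_mul_twisted_derivative hr (-1) hh q)
      simp only [Fin.mk_one, coordChange_pderiv_one, coordChange_cusp, map_neg, map_one, neg_mul,
        one_mul, ← sub_eq_add_neg]
      congr 4
      simp
  · intro q
    have e : q * coordChange (X 0 * X 1 * ((X 0 + X 1) ^ 2 - (X 0 - X 1) ^ 5)) =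
        MvPolynomial.C 4⁻¹ * ((X 0 ^ 2 - X 1 ^ 5) * ((X 0 ^ 2 - X 1 ^ 2) * q)) := by
      rw [map_mul, coordChange_cusp, coordChange_X_mul_X]
      ring
    rw [e, residue_C_mul, add_zero, h₀, mul_zero]

lemma residue_cusp_mul_one {r : ℕ} (hr : r < 2) (q : MvPolynomial (Fin 2) ℚ) :
    residue r 1 ((X 0 ^ 2 - X 1 ^ 5) * ((X 0 ^ 2 - X 1 ^ 2) * q)) = 0 := by
  refine (residue_mul_succ r 0 _).trans ?_
  have : residue r 0 ∘ₗ LinearMap.mulLeft ℚ (X 0 ^ 2 - X 1 ^ 2) = 0 := by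
    refine linearMap_ext_fin_two fun a b => ?_
    have h : (X 0 ^ 2 - X 1 ^ 2 : MvPolynomial (Fin 2) ℚ) * (X 0 ^ a * X 1 ^ b) =
        X 0 ^ (a + 2) * X 1 ^ b - X 0 ^ a * X 1 ^ (b + 2) := by ring
    rw [LinearMap.comp_apply, LinearMap.mulLeft_apply, h, map_sub, residue_monomial,
      residue_monomial, momentCoeff, momentCoeff, if_neg (by omega), if_neg (by omega), sub_zero,
      LinearMap.zero_apply]
  exact congrArg (fun L => L q) this

lemma residue_sub_mul_pow (r n b : ℕ) :
    residue r n ((X 0 ^ 2 - X 1 ^ 2) * X 1 ^ b) =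
      momentCoeff r n 2 b - momentCoeff r n 0 (b + 2) := by
  rw [← residue_monomial, ← residue_monomial, ← map_sub]
  congr 1
  ring

lemma eval_neg_one_eq_zero {b : Polynomial ℚ}
    (hb : SatisfiesBS ((X 0 + X 1) ^ 2 - (X 0 - X 1) ^ 5 : MvPolynomial (Fin 2) ℚ) (X 0 * X 1) b) :
    b.eval (-1) = 0 := by
  have key := exists_pow_mul_mem_of_satisfiesBS cusp_ne_zero (-1)
    (fun k => Ideal.span {((X 0 + X 1) ^ 2 - (X 0 - X 1) ^ 5 : MvPolynomial (Fin 2) ℚ) ^ (k + 1)})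
    ?_ ?_ ?_ hb
  · obtain ⟨k, hk⟩ := key
    rw [Ideal.mem_span_singleton, pow_succ,
      mul_dvd_mul_iff_left (pow_ne_zero k cusp_ne_zero)] at hk
    obtain ⟨c, hc⟩ := hk
    have := congrArg (MvPolynomial.eval ![18, 14]) hc
    norm_num at this
    exact this
  · intro k h hh
    rw [Ideal.mem_span_singleton] at hh ⊢
    rw [pow_succ']
    exact mul_dvd_mul_left _ hh
  · intro k i h hh
    rw [Ideal.mem_span_singleton] at hh ⊢
    obtain ⟨c, rfl⟩ := hh
    generalize ((X 0 + X 1) ^ 2 - (X 0 - X 1) ^ 5 : MvPolynomial (Fin 2) ℚ) = f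
    refine ⟨MvPolynomial.pderiv i c, ?_⟩
    rw [MvPolynomial.pderiv_mul, MvPolynomial.pderiv_pow, add_tsub_cancel_right, map_sub, map_neg,
      map_one, map_natCast]
    push_cast
    ring
  · rw [Ideal.mem_span_singleton, zero_add, pow_one]
    exact dvd_mul_left _ _

end LowerBound

theorem bernsteinSato_stmt_14 :
    ∀ b : Polynomial ℚ,
      SatisfiesBS ((X 0 + X 1) ^ 2 - (X 0 - X 1) ^ 5 : MvPolynomial (Fin 2) ℚ)
          (X 0 * X 1) b ↔
        (Polynomial.X + Polynomial.C (1 : ℚ)) *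
            (Polynomial.X + Polynomial.C (11 / 10 : ℚ)) *
            (Polynomial.X + Polynomial.C (13 / 10 : ℚ)) *
            (Polynomial.X + Polynomial.C (17 / 10 : ℚ)) *
            (Polynomial.X + Polynomial.C (19 / 10 : ℚ)) ∣ b := by
  intro b
  constructor
  · intro hb
    have dvd {a : ℚ} (h : b.eval (-a) = 0) : Polynomial.X + Polynomial.C a ∣ b := by
      have := Polynomial.dvd_iff_isRoot.2 h
      rwa [map_neg, sub_neg_eq_add] at this
    have cop {a c : ℚ} (h : c - a ≠ 0) :
        IsCoprime (Polynomial.X + Polynomial.C a) (Polynomial.X + Polynomial.C c) := by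
      have := Polynomial.isCoprime_X_sub_C_of_isUnit_sub (a := -a) (b := -c)
        (IsUnit.mk0 _ (by rwa [neg_sub_neg]))
      rwa [map_neg, map_neg, sub_neg_eq_add, sub_neg_eq_add] at this
    have h₁₁ : b.eval (-(11 / 10)) = 0 := by
      have := eval_eq_zero_of_residue (r := 2) (κ := 0) (by norm_num)
        (fun q => residue_mul_zero 2 _)
        (q := X 1 ^ 0) (by rw [residue_sub_mul_pow]; norm_num [momentCoeff]) hb
      norm_num at this
      exact this
    have h₁₃ : b.eval (-(13 / 10)) = 0 := by
      have := eval_eq_zero_of_residue (r := 3) (κ := 0) (by norm_num)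
        (fun q => residue_mul_zero 3 _)
        (q := X 1 ^ 1) (by rw [residue_sub_mul_pow]; norm_num [momentCoeff]) hb
      norm_num at this
      exact this
    have h₁₇ : b.eval (-(17 / 10)) = 0 := by
      have := eval_eq_zero_of_residue (r := 0) (κ := 1) (by norm_num)
        (residue_cusp_mul_one (by norm_num))
        (q := X 1 ^ 0) (by rw [residue_sub_mul_pow]; norm_num [momentCoeff]) hb
      norm_num at this
      exact this
    have h₁₉ : b.eval (-(19 / 10)) = 0 := by
      have := eval_eq_zero_of_residue (r := 1) (κ := 1) (by norm_num)
        (residue_cusp_mul_one (by norm_num))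
        (q := X 1 ^ 1) (by rw [residue_sub_mul_pow]; norm_num [momentCoeff]) hb
      norm_num at this
      exact this
    refine IsCoprime.mul_dvd ?_ (IsCoprime.mul_dvd ?_ (IsCoprime.mul_dvd ?_ (IsCoprime.mul_dvd ?_
      (dvd (eval_neg_one_eq_zero hb)) (dvd h₁₁)) (dvd h₁₃)) (dvd h₁₇)) (dvd h₁₉)
    · exact (((cop (by norm_num)).mul_left (cop (by norm_num))).mul_left
        (cop (by norm_num))).mul_left (cop (by norm_num))
    · exact ((cop (by norm_num)).mul_left (cop (by norm_num))).mul_left (cop (by norm_num))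
    · exact (cop (by norm_num)).mul_left (cop (by norm_num))
    · exact cop (by norm_num)
  · rintro ⟨c, rfl⟩
    rw [satisfiesBS_iff_mem]
    set f : MvPolynomial (Fin 2) ℚ := (X 0 + X 1) ^ 2 - (X 0 - X 1) ^ 5 with hf
    set S := bsModule f (X 0 * X 1)
    let D (ε : ℚ) : Derivation ℚ (MvPolynomial (Fin 2) ℚ) (MvPolynomial (Fin 2) ℚ) :=
      (2⁻¹ : ℚ) • (MvPolynomial.pderiv 0 + ε • MvPolynomial.pderiv 1)
    have hD (ε : ℚ) (p) : D ε p = MvPolynomial.C 2⁻¹ * (MvPolynomial.pderiv 0 p +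
        MvPolynomial.C ε * MvPolynomial.pderiv 1 p) := by
      simp [D, MvPolynomial.smul_eq_C_mul, mul_add]
    have hDS (ε : ℚ) : ∀ F ∈ S, (fun m => D ε (F m)) ∈ S := by
      intro F hF
      simp only [hD]
      exact S.smul_mem (MvPolynomial.C 2⁻¹) (S.add_mem (pderiv_mem_bsModule 0 hF)
        (S.smul_mem (MvPolynomial.C ε) (pderiv_mem_bsModule 1 hF)))
    have half := C_half_mul_two
    have hG : (fun m => ((X 0 - X 1) ^ 2 - (X 0 + X 1) ^ 2) * f ^ (m + 1)) ∈ S := by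
      convert S.smul_mem (-4) (pdIter_mem_bsModule (f := f) (g := X 0 * X 1) 0) using 1
      funext m
      simp only [pdIter_zero, Pi.smul_apply, smul_eq_mul]
      ring
    have key := mul_mem_of_derivation_stable (D 1) (D (-1)) (u := X 0 + X 1) (v := X 0 - X 1)
      (by simp [hD]; linear_combination half) (by simp [hD]) (by simp [hD])
      (by simp [hD]; linear_combination half) hf S
      (fun F hF => by simpa using eval_mul_mem_bsModule Polynomial.X hF) (hDS 1) (hDS (-1)) hG
    convert S.smul_mem (MvPolynomial.C (-1 / 40000))
      (eval_mul_mem_bsModule (c.map MvPolynomial.C) key) using 1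
    funext m
    have hc : Polynomial.eval (m : MvPolynomial (Fin 2) ℚ) (c.map MvPolynomial.C) =
        MvPolynomial.C (c.eval (m : ℚ)) := by
      rw [← map_natCast (MvPolynomial.C : ℚ →+* MvPolynomial (Fin 2) ℚ), Polynomial.eval_map_apply]
    have hl (a : ℕ) : MvPolynomial.C ((m : ℚ) + a / 10) * 10 =
        (10 * m + a : MvPolynomial (Fin 2) ℚ) := by
      rw [← map_ofNat (MvPolynomial.C : ℚ →+* MvPolynomial (Fin 2) ℚ) 10,
        ← map_natCast (MvPolynomial.C : ℚ →+* MvPolynomial (Fin 2) ℚ) m,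
        ← map_natCast (MvPolynomial.C : ℚ →+* MvPolynomial (Fin 2) ℚ) a,
        ← map_mul, ← map_mul, ← map_add]
      congr 1
      ring
    have hk : (MvPolynomial.C (-1 / 40000) : MvPolynomial (Fin 2) ℚ) * (-40000) = 1 := by
      rw [← map_ofNat (MvPolynomial.C : ℚ →+* MvPolynomial (Fin 2) ℚ) 40000, ← map_neg, ← map_mul]
      norm_num
    have l₁₁ := hl 11
    have l₁₃ := hl 13
    have l₁₇ := hl 17
    have l₁₉ := hl 19
    push_cast at l₁₁ l₁₃ l₁₇ l₁₉
    simp only [Pi.smul_apply, smul_eq_mul, hc, ← l₁₁, ← l₁₃, ← l₁₇, ← l₁₉, Polynomial.eval_mul,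
      Polynomial.eval_add, Polynomial.eval_X, Polynomial.eval_C, map_mul]
    rw [map_add (MvPolynomial.C : ℚ →+* MvPolynomial (Fin 2) ℚ) (m : ℚ) 1, map_natCast, map_one]
    generalize MvPolynomial.C (-1 / 40000) = e at hk ⊢
    linear_combination (-((m + 1) * MvPolynomial.C ((m : ℚ) + 11 / 10) *
      MvPolynomial.C ((m : ℚ) + 13 / 10) * MvPolynomial.C ((m : ℚ) + 17 / 10) *
      MvPolynomial.C ((m : ℚ) + 19 / 10) * MvPolynomial.C (c.eval (m : ℚ)) * (X 0 * X 1) *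
      f ^ m)) * hk
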